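/- Let n ≥ 8, k ≥ 2, s ≥ 3 be integers and let F ⊆ [n]^k with |F| = (s−1)·n^{k−1} + 1. Let p_F be the probability that |F ∩ M| ≠ s−1 for a uniformly random perfect matching M in [n]^k, and assume p_F ≤ 1/(4n(s−1)). Then all F-fat hyperplanes are parallel: if |H_i(a) ∩ F| ≥ (1 − 2p_F)·n^{k−1} and |H_j(b) ∩ F| ≥ (1 − 2p_F)·n^{k−1} for some i, j ∈ [k] and a, b ∈ [n], then i = j. -/

import Mathlib

/-- The perfect matching of `[n]^k` determined by a tuple of permutations `σ`:
its members are the tuples `(σ 0 t, …, σ (k-1) t)` for `t ∈ [n]`. Every perfect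
matching arises this way, each from exactly `n!` tuples `σ`, so uniform probabilities
over perfect matchings agree with uniform probabilities over `σ`. -/
def matchingOf {n k : ℕ} (σ : Fin k → Equiv.Perm (Fin n)) : Finset (Fin k → Fin n) :=
  Finset.univ.image (fun t : Fin n => fun j : Fin k => σ j t)

/-- `pFrac n k s F` is the probability that `|F ∩ M| ≠ s - 1` for a uniformly random
perfect matching `M` of `[n]^k`. -/
noncomputable def pFrac (n k s : ℕ) (F : Finset (Fin k → Fin n)) : ℝ :=
  ((Finset.univ.filter
      (fun σ : Fin k → Equiv.Perm (Fin n) => (F ∩ matchingOf σ).card ≠ s - 1)).card : ℝ) /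
    ((Finset.univ : Finset (Fin k → Equiv.Perm (Fin n))).card : ℝ)

open Equiv Finset

/-- The `t`-th member of the matching determined by `σ`. -/
def matchingRow {n k : ℕ} (σ : Fin k → Perm (Fin n)) (t : Fin n) : Fin k → Fin n :=
  fun l => σ l t

theorem card_inter_matchingOf {n k : ℕ} (i : Fin k) (F : Finset (Fin k → Fin n))
    (σ : Fin k → Perm (Fin n)) :
    (F ∩ matchingOf σ).card = ∑ t, if matchingRow σ t ∈ F then 1 else 0 := by
  rw [← card_filter]
  symm
  refine card_bij (fun t _ => matchingRow σ t) ?_ ?_ ?_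
  · intro t ht
    exact mem_inter.2 ⟨(mem_filter.1 ht).2, mem_image_of_mem _ (mem_univ t)⟩
  · intro t _ u _ h
    exact (σ i).injective (congrFun h i)
  · intro x hx
    simp only [matchingOf, mem_inter, mem_image, mem_univ, true_and] at hx
    obtain ⟨hxF, t, rfl⟩ := hx
    exact ⟨t, mem_filter.2 ⟨mem_univ t, hxF⟩, rfl⟩

theorem card_inter_matchingOf_comp {n k : ℕ} (i : Fin k) (F : Finset (Fin k → Fin n))
    (σ : Fin k → Perm (Fin n)) (π : Perm (Fin n)) :
    (F ∩ matchingOf (fun l => σ l * π)).card = (F ∩ matchingOf σ).card := by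
  rw [card_inter_matchingOf i, card_inter_matchingOf i]
  exact Equiv.sum_comp π (fun t => if matchingRow σ t ∈ F then 1 else 0)

/-- Each tuple is equally likely to be the `t`-th member of a random matching. -/
theorem card_matchingRow_mem {n k : ℕ} (t : Fin n) (T : Finset (Fin k → Fin n)) :
    n ^ k * #{σ : Fin k → Perm (Fin n) | matchingRow σ t ∈ T} =
      #T * #(univ : Finset (Fin k → Perm (Fin n))) := by
  have hfib (x y : Fin k → Fin n) : #{σ : Fin k → Perm (Fin n) | matchingRow σ t = x} =
      #{σ : Fin k → Perm (Fin n) | matchingRow σ t = y} := by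
    refine card_equiv (Equiv.piCongrRight fun l => Equiv.mulLeft (swap (x l) (y l))) ?_
    intro σ
    simp only [mem_filter, mem_univ, true_and, funext_iff, matchingRow]
    refine forall_congr' fun l => ?_
    simp [Equiv.swap_apply_eq_iff]
  have hsum (T : Finset (Fin k → Fin n)) (x : Fin k → Fin n) :
      #{σ : Fin k → Perm (Fin n) | matchingRow σ t ∈ T} =
        #T * #{σ : Fin k → Perm (Fin n) | matchingRow σ t = x} := by
    rw [card_eq_sum_card_fiberwise (f := fun σ => matchingRow σ t) (t := T)
      (fun σ hσ => by simpa using hσ)]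
    refine sum_const_nat fun y hy => ?_
    rw [← hfib y x, filter_filter]
    congr 1
    ext σ
    simp only [mem_filter, mem_univ, true_and]
    exact ⟨fun h => h.2, fun h => ⟨h ▸ hy, h⟩⟩
  have huniv := hsum univ (fun _ => t)
  rw [hsum T (fun _ => t)]
  simp only [mem_univ, filter_true, card_univ (α := Fin k → Fin n), Fintype.card_fun,
    Fintype.card_fin] at huniv
  rw [huniv]
  ring

theorem mul_card_filter_apply_le {n k : ℕ} {B : Finset (Fin k → Perm (Fin n))}
    (hB : ∀ σ π, σ ∈ B → (fun l => σ l * π) ∈ B) (i : Fin k) (a : Fin n) (z : Fin n) :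
    n * #{σ ∈ B | σ i z = a} ≤ #B := by
  have : n * #{σ ∈ B | σ i z = a} = #((univ : Finset (Fin n)) ×ˢ {σ ∈ B | σ i z = a}) := by
    simp
  rw [this]
  refine card_le_card_of_injOn (fun q l => q.2 l * swap z q.1) ?_ ?_
  · rintro ⟨t, σ⟩ h
    simp only [coe_product, Set.mem_prod, mem_coe, mem_filter] at h
    exact hB _ _ h.2.1
  · rintro ⟨t, σ⟩ h ⟨u, τ⟩ h' e
    simp only [coe_product, Set.mem_prod, mem_coe, mem_filter] at h h'
    have ei : σ i * swap z t = τ i * swap z u := congrFun e i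
    have htu : t = u := by
      apply (σ i * swap z t).injective
      rw [Perm.mul_apply, swap_apply_right, ei, Perm.mul_apply, swap_apply_right, h.2.2, h'.2.2]
    subst htu
    refine Prod.ext rfl (funext fun l => ?_)
    exact mul_right_cancel (congrFun e l)

theorem exists_perm_apply_pair {α : Type*} [DecidableEq α] {t u z o : α} (htu : t ≠ u)
    (hzo : z ≠ o) : ∃ π : Perm α, π t = z ∧ π u = o := by
  refine ⟨swap (swap t z u) o * swap t z, ?_, ?_⟩
  · rw [Perm.mul_apply, swap_apply_left]
    refine swap_apply_of_ne_of_ne (fun h => htu ?_) hzo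
    apply (swap t z).injective
    rw [swap_apply_left, ← h]
  · rw [Perm.mul_apply, swap_apply_left]

theorem mul_card_filter_apply_pair_le {n k : ℕ} {B : Finset (Fin k → Perm (Fin n))}
    (hB : ∀ σ π, σ ∈ B → (fun l => σ l * π) ∈ B) (i j : Fin k) (a b : Fin n)
    {z o : Fin n} (hzo : z ≠ o) :
    (n * (n - 1)) * #{σ ∈ B | σ i z = a ∧ σ j o = b} ≤ #B := by
  have hc : (n * (n - 1)) * #{σ ∈ B | σ i z = a ∧ σ j o = b} =
      #((univ : Finset (Fin n)).offDiag ×ˢ {σ ∈ B | σ i z = a ∧ σ j o = b}) := by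
    simp [offDiag_card, Nat.mul_sub]
  have hπ (q : Fin n × Fin n) : ∃ π : Perm (Fin n), q.1 ≠ q.2 → π q.1 = z ∧ π q.2 = o := by
    by_cases h : q.1 = q.2
    · exact ⟨1, fun h' => absurd h h'⟩
    · obtain ⟨π, hπ⟩ := exists_perm_apply_pair h hzo
      exact ⟨π, fun _ => hπ⟩
  choose π hπ using hπ
  rw [hc]
  refine card_le_card_of_injOn (fun q l => q.2 l * π q.1) ?_ ?_
  · rintro ⟨t, σ⟩ h
    simp only [coe_product, Set.mem_prod, mem_coe, mem_filter] at h
    exact hB _ _ h.2.1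
  · rintro ⟨t, σ⟩ h ⟨u, τ⟩ h' e
    simp only [coe_product, Set.mem_prod, mem_coe, mem_filter, mem_offDiag] at h h'
    have ei : σ i * π t = τ i * π u := congrFun e i
    have ej : σ j * π t = τ j * π u := congrFun e j
    obtain ⟨ht1, ht2⟩ := hπ t h.1.2.2
    obtain ⟨hu1, hu2⟩ := hπ u h'.1.2.2
    have h1 : t.1 = u.1 := by
      apply (σ i * π t).injective
      rw [Perm.mul_apply, ht1, ei, Perm.mul_apply, hu1, h.2.2.1, h'.2.2.1]
    have h2 : t.2 = u.2 := by
      apply (σ j * π t).injective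
      rw [Perm.mul_apply, ht2, ej, Perm.mul_apply, hu2, h.2.2.2, h'.2.2.2]
    obtain rfl : t = u := Prod.ext h1 h2
    refine Prod.ext rfl (funext fun l => ?_)
    exact mul_right_cancel (congrFun e l)

theorem mul_card_matchingRow_mem_le {n k : ℕ} (T : Finset (Fin k → Fin n)) (j : Fin k)
    (b : Fin n) {z o : Fin n} (hzo : z ≠ o) :
    (n - 1) * #{σ : Fin k → Perm (Fin n) | matchingRow σ z ∈ T ∧ σ j o = b} ≤
      #{σ : Fin k → Perm (Fin n) | matchingRow σ z ∈ T} := by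
  have hc : (n - 1) * #{σ : Fin k → Perm (Fin n) | matchingRow σ z ∈ T ∧ σ j o = b} =
      #((univ : Finset (Fin n)).erase z ×ˢ
        ({σ | matchingRow σ z ∈ T ∧ σ j o = b} : Finset (Fin k → Perm (Fin n)))) := by
    simp
  rw [hc]
  refine card_le_card_of_injOn
    (fun q => Function.update q.2 j (q.2 j * swap o q.1)) ?_ ?_
  · rintro ⟨u, σ⟩ h
    simp only [coe_product, Set.mem_prod, mem_coe, mem_filter, mem_erase, mem_univ,
      true_and, and_true] at h ⊢
    convert h.2.1 using 1
    funext l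
    by_cases hl : l = j
    · subst hl
      simp [matchingRow, swap_apply_of_ne_of_ne hzo h.1.symm]
    · simp [matchingRow, hl]
  · rintro ⟨t, σ⟩ h ⟨u, τ⟩ h' e
    simp only [coe_product, Set.mem_prod, mem_coe, mem_filter, mem_univ, true_and] at h h' e
    have ej : σ j * swap o t = τ j * swap o u := by simpa using congrFun e j
    have htu : t = u := by
      apply (σ j * swap o t).injective
      rw [Perm.mul_apply, swap_apply_right, ej, Perm.mul_apply, swap_apply_right, h.2.2, h'.2.2]
    subst htu
    refine Prod.ext rfl (funext fun l => ?_)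
    by_cases hl : l = j
    · subst hl
      exact mul_right_cancel ej
    · simpa [hl] using congrFun e l

theorem card_matchingRow_mem_le {n k : ℕ} {S : Finset (Fin k → Fin n)} {i j : Fin k}
    (hij : i ≠ j) {a b : Fin n} (hS : ∀ x ∈ S, x i ≠ a ∧ x j ≠ b) {z o : Fin n} (hzo : z ≠ o) :
    #{σ : Fin k → Perm (Fin n) | matchingRow σ o ∈ S} ≤
      (n - 1) ^ 2 *
        #{σ : Fin k → Perm (Fin n) | matchingRow σ o ∈ S ∧ σ i z = a ∧ σ j z = b} := by
  have hc : (n - 1) ^ 2 *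
        #{σ : Fin k → Perm (Fin n) | matchingRow σ o ∈ S ∧ σ i z = a ∧ σ j z = b} =
      #(((univ : Finset (Fin n)).erase o ×ˢ (univ : Finset (Fin n)).erase o) ×ˢ
        ({σ | matchingRow σ o ∈ S ∧ σ i z = a ∧ σ j z = b} :
          Finset (Fin k → Perm (Fin n)))) := by
    simp [sq]
  rw [hc]
  refine card_le_card_of_injOn
    (fun σ => (((σ i).symm a, (σ j).symm b),
      Function.update (Function.update σ i (σ i * swap z ((σ i).symm a))) j
        (σ j * swap z ((σ j).symm b)))) ?_ ?_
  · intro σ h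
    simp only [coe_filter, mem_univ, true_and, Set.mem_ofPred_eq] at h
    have hi : o ≠ (σ i).symm a := fun e => (hS _ h).1 (by simp [matchingRow, e])
    have hj : o ≠ (σ j).symm b := fun e => (hS _ h).2 (by simp [matchingRow, e])
    simp only [coe_product, Set.mem_prod, mem_coe, mem_filter, mem_erase, mem_univ,
      true_and, and_true]
    refine ⟨⟨hi.symm, hj.symm⟩, ?_, ?_, ?_⟩
    · convert h using 1
      funext l
      by_cases hl : l = j
      · subst hl
        simp [matchingRow, swap_apply_of_ne_of_ne hzo.symm hj]
      · by_cases hl' : l = i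
        · subst hl'
          simp [matchingRow, hl, swap_apply_of_ne_of_ne hzo.symm hi]
        · simp [matchingRow, hl, hl']
    · simp [hij]
    · simp
  · intro σ _ τ _ e
    simp only [Prod.mk.injEq] at e
    obtain ⟨⟨e1, e2⟩, e⟩ := e
    rw [e1, e2] at e
    funext l
    by_cases hl : l = j
    · subst hl
      simpa using congrFun e l
    · by_cases hl' : l = i
      · subst hl'
        simpa [hl] using congrFun e l
      · simpa [hl, hl'] using congrFun e l

/-- Exchanging the `j`-th coordinates of the members of a matching at positions `z` and `o`. -/
def switchCoord {n k : ℕ} (j : Fin k) (z o : Fin n) (σ : Fin k → Perm (Fin n)) :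
    Fin k → Perm (Fin n) :=
  Function.update σ j (σ j * swap z o)

theorem switchCoord_injective {n k : ℕ} (j : Fin k) (z o : Fin n) :
    Function.Injective (switchCoord j z o) := by
  intro σ τ e
  funext l
  by_cases hl : l = j
  · subst hl
    simpa [switchCoord] using congrFun e l
  · simpa [switchCoord, hl] using congrFun e l

theorem matchingRow_mem_of_switchCoord {n k : ℕ} {F : Finset (Fin k → Fin n)} {j : Fin k}
    {z o : Fin n} (hzo : z ≠ o) {σ : Fin k → Perm (Fin n)}
    (hcard : (F ∩ matchingOf σ).card = (F ∩ matchingOf (switchCoord j z o σ)).card)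
    (hz : matchingRow (switchCoord j z o σ) z ∈ F)
    (ho : matchingRow (switchCoord j z o σ) o ∈ F) : matchingRow σ o ∈ F := by
  rw [card_inter_matchingOf j, card_inter_matchingOf j] at hcard
  have hsplit (f : Fin n → ℕ) : ∑ t, f t = f z + f o + ∑ t ∈ (univ.erase z).erase o, f t := by
    rw [← add_sum_erase _ _ (mem_univ z),
      ← add_sum_erase _ _ (mem_erase.2 ⟨hzo.symm, mem_univ o⟩), add_assoc]
  have hrest : ∑ t ∈ (univ.erase z).erase o, (if matchingRow σ t ∈ F then 1 else 0) =
      ∑ t ∈ (univ.erase z).erase o,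
        if matchingRow (switchCoord j z o σ) t ∈ F then 1 else 0 := by
    refine sum_congr rfl fun t ht => ?_
    simp only [mem_erase, mem_univ, and_true] at ht
    have : matchingRow (switchCoord j z o σ) t = matchingRow σ t := by
      funext l
      by_cases hl : l = j
      · subst hl
        simp [matchingRow, switchCoord, swap_apply_of_ne_of_ne ht.2 ht.1]
      · simp [matchingRow, switchCoord, hl]
    rw [this]
  rw [hsplit, hsplit (fun t => if matchingRow (switchCoord j z o σ) t ∈ F then 1 else 0),
    hrest] at hcard
  by_contra hmem
  simp only [if_pos hz, if_pos ho, if_neg hmem] at hcard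
  split_ifs at hcard <;> omega

theorem card_switch_le {n k s : ℕ} (F : Finset (Fin k → Fin n)) {i j : Fin k} (hij : i ≠ j)
    (a b : Fin n) {z o : Fin n} (hzo : z ≠ o) (B : Finset (Fin k → Perm (Fin n)))
    (hB : ∀ σ, σ ∈ B ↔ (F ∩ matchingOf σ).card ≠ s - 1) :
    #{σ : Fin k → Perm (Fin n) | matchingRow σ o ∉ F ∧ σ i z = a ∧ σ j z = b} ≤
      #{σ ∈ B | σ i z = a} + #{σ ∈ B | σ i z = a ∧ σ j o = b} +
      #{σ : Fin k → Perm (Fin n) |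
        matchingRow σ z ∈ ({x | x i = a ∧ x ∉ F} : Finset _) ∧ σ j o = b} +
      #{σ : Fin k → Perm (Fin n) |
        matchingRow σ o ∈ ({x | x j = b ∧ x ∉ F} : Finset _) ∧ σ i z = a} := by
  set P : Finset (Fin k → Perm (Fin n)) := {σ ∈ B | σ i z = a ∧ σ j o = b} with hP
  set X : Finset (Fin k → Perm (Fin n)) :=
    {σ | matchingRow σ z ∈ ({x | x i = a ∧ x ∉ F} : Finset _) ∧ σ j o = b} with hX
  set Y : Finset (Fin k → Perm (Fin n)) :=
    {σ | matchingRow σ o ∈ ({x | x j = b ∧ x ∉ F} : Finset _) ∧ σ i z = a} with hY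
  set A : Finset (Fin k → Perm (Fin n)) :=
    {σ | matchingRow σ o ∉ F ∧ σ i z = a ∧ σ j z = b} with hA
  have h1 : #{σ ∈ A | σ ∉ B} ≤ #(P ∪ X ∪ Y) := by
    refine card_le_card_of_injOn (switchCoord j z o) ?_ (switchCoord_injective j z o).injOn
    intro σ hσ
    simp only [hA, coe_filter, mem_filter, mem_univ, true_and, Set.mem_ofPred_eq] at hσ
    obtain ⟨⟨hF, hi, hj⟩, hσB⟩ := hσ
    have hi' : switchCoord j z o σ i z = a := by simp [switchCoord, hij, hi]
    have hj' : switchCoord j z o σ j o = b := by simp [switchCoord, hj]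
    simp only [coe_union, Set.mem_union, mem_coe, hP, hX, hY, mem_filter, mem_univ, true_and]
    by_contra hcon
    push Not at hcon
    obtain ⟨⟨c1, c2⟩, c3⟩ := hcon
    have d1 : switchCoord j z o σ ∉ B := fun h => c1 h hi' hj'
    have d2 : matchingRow (switchCoord j z o σ) z ∈ F := by
      by_contra h
      exact c2 ⟨hi', h⟩ hj'
    have d3 : matchingRow (switchCoord j z o σ) o ∈ F := by
      by_contra h
      exact c3 ⟨hj', h⟩ hi'
    rw [hB, not_not] at d1 hσB
    exact hF (matchingRow_mem_of_switchCoord hzo (hσB.trans d1.symm) d2 d3)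
  have h2 : #{σ ∈ A | σ ∈ B} ≤ #{σ ∈ B | σ i z = a} := by
    refine card_le_card fun σ hσ => ?_
    simp only [hA, mem_filter, mem_univ, true_and] at hσ ⊢
    exact ⟨hσ.2, hσ.1.2.1⟩
  have h3 := card_filter_add_card_filter_not (s := A) (fun σ => σ ∈ B)
  have h4 := card_union_le (P ∪ X) Y
  have h5 := card_union_le P X
  omega

theorem card_coord_eq {n k : ℕ} (i : Fin k) (a : Fin n) :
    #{x : Fin k → Fin n | x i = a} = n ^ (k - 1) := by
  have h : ({x : Fin k → Fin n | x i = a} : Finset _) =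
      Fintype.piFinset (Function.update (fun _ => (univ : Finset (Fin n))) i ({a} : Finset (Fin n))) := by
    ext x
    simp only [mem_filter, mem_univ, true_and, Fintype.mem_piFinset]
    refine ⟨fun h l => ?_, fun h => by simpa using h i⟩
    by_cases hl : l = i
    · subst hl
      simpa using h
    · simp [hl]
  rw [h, Fintype.card_piFinset, ← mul_prod_erase univ _ (mem_univ i)]
  rw [prod_congr rfl (g := fun _ => n) (fun l hl => by simp [ne_of_mem_erase hl])]
  simp

/-- Members of a hyperplane outside a fat family are rare. -/
theorem card_coord_eq_not_mem_le {n k : ℕ} (F : Finset (Fin k → Fin n)) (i : Fin k) (a : Fin n)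
    (p : ℝ) (h : (#{x ∈ F | x i = a} : ℝ) ≥ (1 - 2 * p) * (n : ℝ) ^ (k - 1)) :
    (#{x : Fin k → Fin n | x i = a ∧ x ∉ F} : ℝ) ≤ 2 * p * (n : ℝ) ^ (k - 1) := by
  have h1 := card_filter_add_card_filter_not (s := ({x : Fin k → Fin n | x i = a} : Finset _))
    (fun x => x ∈ F)
  rw [card_coord_eq, filter_filter, filter_filter] at h1
  have h2 : ({x : Fin k → Fin n | x i = a ∧ x ∈ F} : Finset _) = {x ∈ F | x i = a} := by
    ext x
    simp [and_comm]
  rw [h2] at h1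
  have h3 : (#{x ∈ F | x i = a} : ℝ) + #{x : Fin k → Fin n | x i = a ∧ x ∉ F} =
      (n : ℝ) ^ (k - 1) := by exact_mod_cast h1
  linarith

theorem card_le_add_hyperplanes {n k : ℕ} (F : Finset (Fin k → Fin n)) (i j : Fin k)
    (a b : Fin n) :
    n ^ k ≤ #F + #{x : Fin k → Fin n | x ∉ F ∧ x i ≠ a ∧ x j ≠ b} +
      #{x : Fin k → Fin n | x i = a ∧ x ∉ F} + #{x : Fin k → Fin n | x j = b ∧ x ∉ F} := by
  set S : Finset (Fin k → Fin n) := {x | x ∉ F ∧ x i ≠ a ∧ x j ≠ b} with hS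
  set X : Finset (Fin k → Fin n) := {x | x i = a ∧ x ∉ F} with hX
  set Y : Finset (Fin k → Fin n) := {x | x j = b ∧ x ∉ F} with hY
  have h : (univ : Finset (Fin k → Fin n)) ⊆ F ∪ S ∪ X ∪ Y := by
    intro x _
    simp only [hS, hX, hY, mem_union, mem_filter, mem_univ, true_and]
    tauto
  have h1 := card_le_card h
  rw [card_univ, Fintype.card_fun, Fintype.card_fin, Fintype.card_fin] at h1
  have h2 := card_union_le (F ∪ S ∪ X) Y
  have h3 := card_union_le (F ∪ S) X
  have h4 := card_union_le F S
  omega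

theorem card_bad_outside_le {n k s : ℕ} (hn : 2 ≤ n) (F : Finset (Fin k → Fin n)) {i j : Fin k}
    (hij : i ≠ j) (a b : Fin n)
    (hi : (#{x ∈ F | x i = a} : ℝ) ≥ (1 - 2 * pFrac n k s F) * (n : ℝ) ^ (k - 1))
    (hj : (#{x ∈ F | x j = b} : ℝ) ≥ (1 - 2 * pFrac n k s F) * (n : ℝ) ^ (k - 1)) :
    (#{x : Fin k → Fin n | x ∉ F ∧ x i ≠ a ∧ x j ≠ b} : ℝ) ≤
      (n : ℝ) ^ (k - 1) * pFrac n k s F * ((n - 1) * (n + 4)) := by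
  set p := pFrac n k s F with hpdef
  set S : Finset (Fin k → Fin n) := {x | x ∉ F ∧ x i ≠ a ∧ x j ≠ b} with hS
  set B : Finset (Fin k → Perm (Fin n)) := {σ | (F ∩ matchingOf σ).card ≠ s - 1} with hB
  set N : ℝ := ((#(univ : Finset (Fin k → Perm (Fin n))) : ℕ) : ℝ) with hN
  obtain ⟨z, o, hzo⟩ : ∃ z o : Fin n, z ≠ o :=
    ⟨⟨0, by omega⟩, ⟨1, by omega⟩, by simp⟩
  have hNpos : 0 < N := by
    rw [hN]
    exact_mod_cast card_pos.2 univ_nonempty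
  have hBp : (#B : ℝ) = p * N := by
    rw [hpdef, pFrac, div_mul_cancel₀ _ hNpos.ne']
  have hBinv : ∀ σ π, σ ∈ B → (fun l => σ l * π) ∈ B := by
    intro σ π h
    simp only [hB, mem_filter, mem_univ, true_and] at h ⊢
    rwa [card_inter_matchingOf_comp i]
  have hn1 : ((n - 1 : ℕ) : ℝ) = n - 1 := by
    rw [Nat.cast_sub (by omega)]
    simp
  have hn2 : (2 : ℝ) ≤ n := by exact_mod_cast hn
  have hk : (n : ℝ) ^ k = n * (n : ℝ) ^ (k - 1) := by
    rw [← pow_succ', Nat.sub_add_cancel (Nat.one_le_of_lt i.isLt)]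
  have hX := card_coord_eq_not_mem_le F i a p hi
  have hY := card_coord_eq_not_mem_le F j b p hj
  have e1 := mul_card_filter_apply_le hBinv i a z
  have e2 := mul_card_filter_apply_pair_le hBinv i j a b hzo
  have e3 := mul_card_matchingRow_mem_le ({x | x i = a ∧ x ∉ F} : Finset (Fin k → Fin n)) j b hzo
  have e3' := card_matchingRow_mem z ({x | x i = a ∧ x ∉ F} : Finset (Fin k → Fin n))
  have e4 := mul_card_matchingRow_mem_le ({x | x j = b ∧ x ∉ F} : Finset (Fin k → Fin n)) i a
    hzo.symm
  have e4' := card_matchingRow_mem o ({x | x j = b ∧ x ∉ F} : Finset (Fin k → Fin n))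
  have e5 := card_matchingRow_mem_le (S := S) hij (a := a) (b := b)
    (fun x hx => (mem_filter.1 hx).2.2) hzo
  have e5' := card_matchingRow_mem o S
  have e6 := card_switch_le (s := s) F hij a b hzo B (fun σ => by simp [hB])
  have e7 : #{σ : Fin k → Perm (Fin n) | matchingRow σ o ∈ S ∧ σ i z = a ∧ σ j z = b} ≤
      #{σ : Fin k → Perm (Fin n) | matchingRow σ o ∉ F ∧ σ i z = a ∧ σ j z = b} := by
    refine card_le_card (monotone_filter_right _ fun σ _ h => ?_)
    exact ⟨(mem_filter.1 h.1).2.1, h.2⟩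
  replace e6 := e7.trans e6
  clear e7
  generalize #{σ : Fin k → Perm (Fin n) | matchingRow σ o ∈ S ∧ σ i z = a ∧ σ j z = b} = w
    at e5 e6
  generalize #{σ : Fin k → Perm (Fin n) | matchingRow σ o ∈ S} = w' at e5 e5'
  generalize #{σ ∈ B | σ i z = a} = w1 at e1 e6
  generalize #{σ ∈ B | σ i z = a ∧ σ j o = b} = w2 at e2 e6
  generalize #{σ : Fin k → Perm (Fin n) |
    matchingRow σ z ∈ ({x | x i = a ∧ x ∉ F} : Finset _) ∧ σ j o = b} = w3 at e3 e6
  generalize #{σ : Fin k → Perm (Fin n) |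
    matchingRow σ z ∈ ({x | x i = a ∧ x ∉ F} : Finset _)} = w3' at e3 e3'
  generalize #{σ : Fin k → Perm (Fin n) |
    matchingRow σ o ∈ ({x | x j = b ∧ x ∉ F} : Finset _) ∧ σ i z = a} = w4 at e4 e6
  generalize #{σ : Fin k → Perm (Fin n) |
    matchingRow σ o ∈ ({x | x j = b ∧ x ∉ F} : Finset _)} = w4' at e4 e4'
  rify at e1 e2 e3 e3' e4 e4' e5 e5' e6
  rw [hn1] at e2 e3 e4 e5
  rw [← hN, hk] at e3' e4' e5'
  rw [hBp] at e1 e2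
  set m : ℝ := (n : ℝ) ^ (k - 1) with hm
  have hmpos : 0 < m := by positivity
  have hq : (0 : ℝ) < n - 1 := by linarith
  have f3 : (n : ℝ) * w3' ≤ 2 * p * N := by
    refine le_of_mul_le_mul_left ?_ hmpos
    linarith [mul_le_mul_of_nonneg_right hX hNpos.le]
  have f4 : (n : ℝ) * w4' ≤ 2 * p * N := by
    refine le_of_mul_le_mul_left ?_ hmpos
    linarith [mul_le_mul_of_nonneg_right hY hNpos.le]
  have g3 : (n : ℝ) * (n - 1) * w3 ≤ 2 * p * N := by
    linarith [mul_le_mul_of_nonneg_left e3 (by positivity : (0 : ℝ) ≤ n)]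
  have g4 : (n : ℝ) * (n - 1) * w4 ≤ 2 * p * N := by
    linarith [mul_le_mul_of_nonneg_left e4 (by positivity : (0 : ℝ) ≤ n)]
  have g1 : (n : ℝ) * (n - 1) * w1 ≤ (n - 1) * (p * N) := by
    linarith [mul_le_mul_of_nonneg_left e1 hq.le]
  have g : (n : ℝ) * (n - 1) * w ≤ (n + 4) * (p * N) := by
    have : (n : ℝ) * (n - 1) * w ≤ n * (n - 1) * (w1 + w2 + w3 + w4) :=
      mul_le_mul_of_nonneg_left e6 (by positivity)
    linarith
  refine le_of_mul_le_mul_right ?_ hNpos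
  calc (#S : ℝ) * N = m * (n * w') := by rw [← e5']; ring
    _ ≤ m * (n * ((n - 1) ^ 2 * w)) := by gcongr
    _ = m * (n - 1) * (n * (n - 1) * w) := by ring
    _ ≤ m * (n - 1) * ((n + 4) * (p * N)) := by gcongr
    _ = m * p * ((n - 1) * (n + 4)) * N := by ring

/-- Theorem 4.1, part 2: all `F`-fat hyperplanes are parallel. -/
theorem stmt11 (n k s : ℕ) (hn : 8 ≤ n) (hk : 2 ≤ k) (hs : 3 ≤ s)
    (F : Finset (Fin k → Fin n)) (hF : F.card = (s - 1) * n ^ (k - 1) + 1)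
    (hp : pFrac n k s F ≤ 1 / (4 * (n : ℝ) * ((s : ℝ) - 1))) :
    ∀ (i j : Fin k) (a b : Fin n),
      ((F.filter (fun x => x i = a)).card : ℝ) ≥
        (1 - 2 * pFrac n k s F) * (n : ℝ) ^ (k - 1) →
      ((F.filter (fun x => x j = b)).card : ℝ) ≥
        (1 - 2 * pFrac n k s F) * (n : ℝ) ^ (k - 1) →
      i = j := by
  intro i j a b hi hj
  by_contra hij
  have hout := card_bad_outside_le (by omega) F hij a b hi hj
  have hX := card_coord_eq_not_mem_le F i a _ hi
  have hY := card_coord_eq_not_mem_le F j b _ hj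
  have htot := card_le_add_hyperplanes F i j a b
  obtain ⟨t, rfl⟩ : ∃ t, s = t + 1 := ⟨s - 1, by omega⟩
  have hkn : n ^ k = n * n ^ (k - 1) := by
    rw [← pow_succ', Nat.sub_add_cancel (by omega)]
  have htn : t < n := by
    have hle := card_le_univ F
    rw [Fintype.card_fun, Fintype.card_fin, Fintype.card_fin, hF, hkn] at hle
    by_contra! h
    have := Nat.mul_le_mul_right (n ^ (k - 1)) h
    simp only [Nat.add_sub_cancel] at hle
    omega
  have hnm : n ≤ n ^ (k - 1) := Nat.le_self_pow (by omega) n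
  rw [hF, hkn, Nat.add_sub_cancel] at htot
  set p := pFrac n k (t + 1) F
  generalize #{x : Fin k → Fin n | x ∉ F ∧ x i ≠ a ∧ x j ≠ b} = S at *
  generalize #{x : Fin k → Fin n | x i = a ∧ x ∉ F} = X at *
  generalize #{x : Fin k → Fin n | x j = b ∧ x ∉ F} = Y at *
  have htot' : (n : ℝ) * (n : ℝ) ^ (k - 1) ≤ t * (n : ℝ) ^ (k - 1) + 1 + S + X + Y := by
    exact_mod_cast htot
  have hnm' : (n : ℝ) ≤ (n : ℝ) ^ (k - 1) := by exact_mod_cast hnm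
  have hn' : (8 : ℝ) ≤ n := by exact_mod_cast hn
  have ht' : (2 : ℝ) ≤ t := by exact_mod_cast (by omega : 2 ≤ t)
  have htn' : (t : ℝ) + 1 ≤ n := by exact_mod_cast htn
  generalize (n : ℝ) ^ (k - 1) = m at *
  have hm : 0 < m := by linarith
  have hp' : 4 * (n * t * p) ≤ 1 := by
    push_cast at hp
    rw [add_sub_cancel_right, le_div_iff₀ (by positivity)] at hp
    linarith
  have h1 : (n : ℝ) * t * ((n - t) * m) ≤
      n * t + m * ((n * t * p) * ((n - 1) * (n + 4) + 4)) := by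
    have : ((n : ℝ) - t) * m ≤ 1 + m * p * ((n - 1) * (n + 4)) + 4 * (p * m) := by linarith
    have := mul_le_mul_of_nonneg_left this (by positivity : (0 : ℝ) ≤ n * t)
    linarith
  have h2 : (n * t * p) * (((n : ℝ) - 1) * (n + 4) + 4) ≤
      1 / 4 * ((n - 1) * (n + 4) + 4) := by
    have : (0 : ℝ) ≤ (n - 1) * (n + 4) + 4 := by nlinarith
    exact mul_le_mul_of_nonneg_right (by linarith) this
  have h3 : (n : ℝ) * t ≤ m * t := by gcongr
  have h4 : (n : ℝ) - 1 ≤ t * (n - t) := by nlinarith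
  have h5 : m * (n * (n - 1)) ≤ m * (t + 1 / 4 * (((n : ℝ) - 1) * (n + 4) + 4)) := by
    have := mul_le_mul_of_nonneg_left h2 hm.le
    have := mul_le_mul_of_nonneg_left h4 (by positivity : 0 ≤ m * n)
    linarith
  have h6 := le_of_mul_le_mul_left h5 hm
  nlinarith
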